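/- For any fixed s ∈ (0,1), the function t ↦ h(st)·h((1−s)t)/h(t) is strictly increasing in t on (0,∞), and its values lie in the open interval (1/2, 1): it tends to 1/2 as t → 0⁺ and to 1 as t → ∞. -/

import Mathlib

open Filter Set

noncomputable def h (t : ℝ) : ℝ :=
  if t = 0 then 1 / 2 else Real.exp t * (Real.exp t - 1 - t) / (Real.exp t - 1) ^ 2

theorem pos_of_hasDerivAt_pos {f f' : ℝ → ℝ} (hf : ∀ t, HasDerivAt f (f' t) t) (h0 : f 0 = 0)
    (hf' : ∀ t, 0 < t → 0 < f' t) (t : ℝ) (ht : 0 < t) : 0 < f t := by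
  have hmono : StrictMonoOn f (Set.Ici 0) := by
    apply strictMonoOn_of_deriv_pos (convex_Ici 0)
    · exact fun x _ => (hf x).continuousAt.continuousWithinAt
    · intro x hx
      rw [interior_Ici] at hx
      rw [(hf x).deriv]
      exact hf' x hx
  simpa [h0] using hmono (Set.mem_Ici.2 le_rfl) (Set.mem_Ici.2 ht.le) ht

theorem hasDerivAt_exp_const_mul (c t : ℝ) :
    HasDerivAt (fun x : ℝ => Real.exp (c * x)) (Real.exp (c * t) * c) t := by
  simpa using ((hasDerivAt_id t).const_mul c).exp

theorem hasDerivAt_const_mul_add (c d t : ℝ) : HasDerivAt (fun x : ℝ => c * x + d) c t := by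
  simpa using ((hasDerivAt_id t).const_mul c).add_const d

theorem exp_cubic_combination_pos (t : ℝ) (ht : 0 < t) :
    0 < (1 * t + -3) * Real.exp (3 * t) + (2 * t + 7) * Real.exp (2 * t)
      - (2 * t ^ 2 + (3 * t + 5)) * Real.exp (1 * t) + 1 := by
  have hsq (c x : ℝ) : HasDerivAt (fun x : ℝ => c * x ^ 2) (c * (2 * x)) x := by
    simpa using (hasDerivAt_pow 2 x).const_mul c
  have e := hasDerivAt_exp_const_mul
  have l := hasDerivAt_const_mul_add
  have e2 (x : ℝ) : Real.exp (2 * x) = Real.exp (1 * x) ^ 2 := by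
    rw [← Real.exp_nat_mul]; congr 1; push_cast; ring
  have e3 (x : ℝ) : Real.exp (3 * x) = Real.exp (1 * x) ^ 3 := by
    rw [← Real.exp_nat_mul]; congr 1; push_cast; ring
  have p5 : ∀ t : ℝ, 0 < t → 0 < (24 * t + -4) * Real.exp (1 * t) + 4 :=
    pos_of_hasDerivAt_pos (fun x => ((l 24 (-4) x).mul (e 1 x)).add_const 4) (by norm_num) <| by
      intro x hx
      have : 0 < (24 * x + 20) * Real.exp (1 * x) := by positivity
      linarith
  have p4 : ∀ t : ℝ, 0 < t → 0 < (24 * t + -28) * Real.exp (1 * t) + (4 * t + 28) :=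
    pos_of_hasDerivAt_pos (fun x => ((l 24 (-28) x).mul (e 1 x)).add (l 4 28 x)) (by norm_num) <| by
      intro x hx
      linarith [p5 x hx]
  have p3 : ∀ t : ℝ, 0 < t →
      0 < (12 * t + -20) * Real.exp (2 * t) + (4 * t + 24) * Real.exp (1 * t) + -4 :=
    pos_of_hasDerivAt_pos (fun x =>
      (((l 12 (-20) x).mul (e 2 x)).add ((l 4 24 x).mul (e 1 x))).add_const (-4)) (by norm_num) <| by
      intro x hx
      have := mul_pos (Real.exp_pos (1 * x)) (p4 x hx)
      rw [e2]
      linarith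
  have p2 : ∀ t : ℝ, 0 < t →
      0 < (6 * t + -13) * Real.exp (2 * t) + (4 * t + 20) * Real.exp (1 * t) - (4 * t + 7) :=
    pos_of_hasDerivAt_pos (fun x =>
      (((l 6 (-13) x).mul (e 2 x)).add ((l 4 20 x).mul (e 1 x))).sub (l 4 7 x)) (by norm_num) <| by
      intro x hx
      linarith [p3 x hx]
  have p1 : ∀ t : ℝ, 0 < t →
      0 < (3 * t + -8) * Real.exp (2 * t) + (4 * t + 16) * Real.exp (1 * t)
        - (2 * t ^ 2 + (7 * t + 8)) :=
    pos_of_hasDerivAt_pos (fun x =>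
      (((l 3 (-8) x).mul (e 2 x)).add ((l 4 16 x).mul (e 1 x))).sub ((hsq 2 x).add (l 7 8 x)))
      (by norm_num) <| by
      intro x hx
      linarith [p2 x hx]
  refine pos_of_hasDerivAt_pos (fun x =>
      ((((l 1 (-3) x).mul (e 3 x)).add ((l 2 7 x).mul (e 2 x))).sub
        (((hsq 2 x).add (l 3 5 x)).mul (e 1 x))).add_const 1) (by norm_num) ?_ t ht
  intro x hx
  have := mul_pos (Real.exp_pos (1 * x)) (p1 x hx)
  simp only [Pi.add_apply, e2, e3] at this ⊢
  linarith

theorem exp_sub_one_pos {t : ℝ} (ht : 0 < t) : 0 < Real.exp t - 1 := by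
  linarith [Real.add_one_lt_exp ht.ne']

theorem exp_sub_one_sub_self_pos {t : ℝ} (ht : 0 < t) : 0 < Real.exp t - 1 - t := by
  linarith [Real.add_one_lt_exp ht.ne']

theorem h_of_pos {t : ℝ} (ht : 0 < t) :
    h t = Real.exp t * (Real.exp t - 1 - t) / (Real.exp t - 1) ^ 2 := if_neg ht.ne'

theorem h_pos {t : ℝ} (ht : 0 < t) : 0 < h t := by
  rw [h_of_pos ht]
  have := exp_sub_one_pos ht
  have := exp_sub_one_sub_self_pos ht
  positivity

/-- The logarithmic derivative of `h` on `(0, ∞)`. -/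
noncomputable def logDerivH (t : ℝ) : ℝ :=
  1 + (Real.exp t - 1) / (Real.exp t - 1 - t) - 2 * (Real.exp t / (Real.exp t - 1))

theorem hasDerivAt_log_h {t : ℝ} (ht : 0 < t) :
    HasDerivAt (fun x => Real.log (h x)) (logDerivH t) t := by
  have ha := exp_sub_one_pos ht
  have hb := exp_sub_one_sub_self_pos ht
  have da : HasDerivAt (fun x => Real.exp x - 1) (Real.exp t) t :=
    (Real.hasDerivAt_exp t).sub_const 1
  have db : HasDerivAt (fun x => Real.exp x - 1 - x) (Real.exp t - 1) t := da.sub (hasDerivAt_id t)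
  refine (((hasDerivAt_id t).add (db.log hb.ne')).sub
    ((da.log ha.ne').const_mul 2)).congr_of_eventuallyEq ?_
  filter_upwards [Ioi_mem_nhds ht] with x hx
  have hax := exp_sub_one_pos hx
  have hbx := exp_sub_one_sub_self_pos hx
  rw [h_of_pos hx, Real.log_div (by positivity) (by positivity),
    Real.log_mul (by positivity) hbx.ne', Real.log_exp, Real.log_pow]
  simp

theorem strictAntiOn_logDerivH : StrictAntiOn logDerivH (Set.Ioi 0) := by
  have hd (t : ℝ) (ht : 0 < t) : ∃ d < 0, HasDerivAt logDerivH d t := by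
    have ha := exp_sub_one_pos ht
    have hb := exp_sub_one_sub_self_pos ht
    have da : HasDerivAt (fun x => Real.exp x - 1) (Real.exp t) t :=
      (Real.hasDerivAt_exp t).sub_const 1
    have db : HasDerivAt (fun x => Real.exp x - 1 - x) (Real.exp t - 1) t :=
      da.sub (hasDerivAt_id t)
    refine ⟨_, ?_, ((da.div db hb.ne').const_add 1).sub
      (((Real.hasDerivAt_exp t).div da ha.ne').const_mul 2)⟩
    have key := exp_cubic_combination_pos t ht
    have e2 : Real.exp (2 * t) = Real.exp t ^ 2 := by
      rw [← Real.exp_nat_mul]; congr 1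
    have e3 : Real.exp (3 * t) = Real.exp t ^ 3 := by
      rw [← Real.exp_nat_mul]; congr 1
    rw [e2, e3, one_mul t] at key
    generalize Real.exp t = E at *
    have : (E * (E - 1 - t) - (E - 1) * (E - 1)) / (E - 1 - t) ^ 2 -
        2 * ((E * (E - 1) - E * E) / (E - 1) ^ 2) =
        -((t + -3) * E ^ 3 + (2 * t + 7) * E ^ 2 - (2 * t ^ 2 + (3 * t + 5)) * E + 1) /
          ((E - 1 - t) ^ 2 * (E - 1) ^ 2) := by
      field_simp
      ring
    rw [this]
    exact div_neg_of_neg_of_pos (neg_neg_of_pos key) (by positivity)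
  apply strictAntiOn_of_deriv_neg (convex_Ioi 0)
  · intro x hx
    obtain ⟨d, -, hx'⟩ := hd x hx
    exact hx'.continuousAt.continuousWithinAt
  · intro x hx
    rw [interior_Ioi] at hx
    obtain ⟨d, hneg, hx'⟩ := hd x hx
    rwa [hx'.deriv]

theorem strictMonoOn_h_ratio {s : ℝ} (hs : s ∈ Set.Ioo (0 : ℝ) 1) :
    StrictMonoOn (fun t : ℝ => h (s * t) * h ((1 - s) * t) / h t) (Set.Ioi 0) := by
  obtain ⟨hs0, hs1⟩ := hs
  have hs2 : 0 < 1 - s := sub_pos.2 hs1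
  have hscale {c t : ℝ} (hc : 0 < c) (ht : 0 < t) :
      HasDerivAt (fun x => Real.log (h (c * x))) (logDerivH (c * t) * c) t := by
    have hl : HasDerivAt (fun x : ℝ => c * x) c t := by
      simpa using (hasDerivAt_id t).const_mul c
    exact (hasDerivAt_log_h (mul_pos hc ht)).comp t hl
  have hd {t : ℝ} (ht : 0 < t) :=
    ((hscale hs0 ht).add (hscale hs2 ht)).sub (hasDerivAt_log_h ht)
  have hlog : StrictMonoOn (((fun x => Real.log (h (s * x))) +
      fun x => Real.log (h ((1 - s) * x))) - fun x => Real.log (h x)) (Set.Ioi 0) := by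
    apply strictMonoOn_of_deriv_pos (convex_Ioi 0)
    · exact fun x hx => (hd hx).continuousAt.continuousWithinAt
    · intro x hx
      rw [interior_Ioi] at hx
      have hx0 : 0 < x := hx
      rw [(hd hx).deriv]
      have h1 : logDerivH x < logDerivH (s * x) :=
        strictAntiOn_logDerivH (mul_pos hs0 hx0) hx (by nlinarith)
      have h2 : logDerivH x < logDerivH ((1 - s) * x) :=
        strictAntiOn_logDerivH (mul_pos hs2 hx0) hx (by nlinarith)
      linarith [mul_lt_mul_of_pos_right h1 hs0, mul_lt_mul_of_pos_right h2 hs2]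
  refine (Real.exp_strictMono.comp_strictMonoOn hlog).congr fun t ht => ?_
  have ht0 : 0 < t := ht
  simp [Real.exp_sub, Real.exp_add, Real.exp_log (h_pos ht0),
    Real.exp_log (h_pos (mul_pos hs0 ht0)), Real.exp_log (h_pos (mul_pos hs2 ht0))]

theorem tendsto_h_nhdsGT_zero : Tendsto h (nhdsWithin 0 (Set.Ioi 0)) (nhds (1 / 2)) := by
  have hne : ∀ᶠ t : ℝ in nhdsWithin 0 (Set.Ioi 0), 0 < t :=
    self_mem_nhdsWithin
  have hb : Tendsto (fun t : ℝ => (Real.exp t - 1 - t) / t ^ 2) (nhdsWithin 0 (Set.Ioi 0))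
      (nhds (1 / 2)) := by
    have := ((Real.exp_sub_sum_range_succ_isLittleO_pow 2).mono
      (nhdsWithin_le_nhds (s := Set.Ioi 0))).tendsto_div_nhds_zero.add_const (1 / 2)
    rw [zero_add] at this
    refine this.congr' ?_
    filter_upwards [hne] with t ht
    simp only [Finset.sum_range_succ, Finset.sum_range_zero]
    norm_num [Nat.factorial]
    field_simp
    ring
  have ha : Tendsto (fun t : ℝ => (Real.exp t - 1) / t) (nhdsWithin 0 (Set.Ioi 0)) (nhds 1) := by
    have := ((Real.exp_sub_sum_range_succ_isLittleO_pow 1).mono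
      (nhdsWithin_le_nhds (s := Set.Ioi 0))).tendsto_div_nhds_zero.add_const 1
    rw [zero_add] at this
    refine this.congr' ?_
    filter_upwards [hne] with t ht
    simp only [Finset.sum_range_succ, Finset.sum_range_zero]
    norm_num [Nat.factorial]
    field_simp
    ring
  have hE : Tendsto Real.exp (nhdsWithin 0 (Set.Ioi 0)) (nhds 1) := by
    simpa using (Real.continuous_exp.tendsto 0).mono_left nhdsWithin_le_nhds
  have := (hE.mul hb).div (ha.pow 2) (by norm_num)
  norm_num at this
  refine this.congr' ?_
  filter_upwards [hne] with t ht
  have := exp_sub_one_pos ht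
  simp only [Pi.div_apply]
  rw [h_of_pos ht]
  field_simp

theorem tendsto_h_atTop : Tendsto h atTop (nhds 1) := by
  have h1 : Tendsto (fun t : ℝ => Real.exp (-t)) atTop (nhds 0) :=
    Real.tendsto_exp_neg_atTop_nhds_zero
  have h2 := Real.tendsto_pow_mul_exp_neg_atTop_nhds_zero 1
  have := ((h1.const_sub 1).sub h2).div ((h1.const_sub 1).pow 2) (by norm_num)
  norm_num at this
  refine this.congr' ?_
  filter_upwards [eventually_gt_atTop 0] with t ht
  have := exp_sub_one_pos ht
  simp only [Pi.div_apply]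
  rw [h_of_pos ht, Real.exp_neg]
  field_simp

theorem h_product_ratio (s : ℝ) (hs : s ∈ Set.Ioo (0:ℝ) 1) :
    StrictMonoOn (fun t : ℝ => h (s * t) * h ((1 - s) * t) / h t) (Set.Ioi 0) ∧
    (∀ t ∈ Set.Ioi (0:ℝ), h (s * t) * h ((1 - s) * t) / h t ∈ Set.Ioo (1/2 : ℝ) 1) ∧
    Tendsto (fun t : ℝ => h (s * t) * h ((1 - s) * t) / h t) (nhdsWithin 0 (Set.Ioi 0))
      (nhds (1/2)) ∧
    Tendsto (fun t : ℝ => h (s * t) * h ((1 - s) * t) / h t) atTop (nhds 1) := by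
  have hmono := strictMonoOn_h_ratio hs
  obtain ⟨hs0, hs1⟩ := hs
  have hs2 : 0 < 1 - s := sub_pos.2 hs1
  have hzero {c : ℝ} (hc : 0 < c) :
      Tendsto (fun t : ℝ => c * t) (nhdsWithin 0 (Set.Ioi 0)) (nhdsWithin 0 (Set.Ioi 0)) := by
    refine tendsto_nhdsWithin_iff.2 ⟨?_, ?_⟩
    · have : Tendsto (fun t : ℝ => c * t) (nhds 0) (nhds (c * 0)) :=
        (continuous_const_mul c).tendsto 0
      rw [mul_zero] at this
      exact this.mono_left nhdsWithin_le_nhds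
    · filter_upwards [self_mem_nhdsWithin] with t ht using mul_pos hc ht
  have hlim0 : Tendsto (fun t : ℝ => h (s * t) * h ((1 - s) * t) / h t)
      (nhdsWithin 0 (Set.Ioi 0)) (nhds (1/2)) := by
    have := ((tendsto_h_nhdsGT_zero.comp (hzero hs0)).mul
      (tendsto_h_nhdsGT_zero.comp (hzero hs2))).div tendsto_h_nhdsGT_zero (by norm_num)
    rwa [mul_div_cancel_right₀ _ (by norm_num)] at this
  have hlim1 : Tendsto (fun t : ℝ => h (s * t) * h ((1 - s) * t) / h t) atTop (nhds 1) := by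
    have := ((tendsto_h_atTop.comp (tendsto_id.const_mul_atTop hs0)).mul
      (tendsto_h_atTop.comp (tendsto_id.const_mul_atTop hs2))).div tendsto_h_atTop one_ne_zero
    rwa [mul_one, div_one] at this
  refine ⟨hmono, fun t ht => ⟨?_, ?_⟩, hlim0, hlim1⟩
  · have ht0 : 0 < t := ht
    have hlt := hmono (half_pos ht0) ht (half_lt_self ht0)
    refine lt_of_le_of_lt (le_of_tendsto hlim0 ?_) hlt
    filter_upwards [Ioo_mem_nhdsGT (half_pos ht0)] with x hx
    exact (hmono hx.1 (half_pos ht0) hx.2).le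
  · have ht0 : 0 < t := ht
    have ht1 : 0 < t + 1 := by linarith
    have hlt := hmono ht ht1 (lt_add_one t)
    refine lt_of_lt_of_le hlt (ge_of_tendsto hlim1 ?_)
    filter_upwards [eventually_gt_atTop (t + 1)] with x hx
    exact (hmono ht1 (ht1.trans hx) hx).le
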